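/- Let K be a separably closed field equipped with a nontrivial valuation v, and let K^alg be an algebraic closure of K equipped with an extension of v. Then K is dense in K^alg for the valuation topology: for every a ∈ K^alg and every γ in the value group of K^alg, there exists b ∈ K with v(a − b) > γ. -/

import Mathlib

theorem aux_small {K Kbar Γ₀ : Type} [Field K] [Field Kbar] [Algebra K Kbar]
    [IsPurelyInseparable K Kbar] [LinearOrderedCommGroupWithZero Γ₀]
    (v : Valuation K Γ₀) (w : Valuation Kbar Γ₀)
    (hext : ∀ x : K, w (algebraMap K Kbar x) = v x)
    (hnontriv : ∃ x : K, x ≠ 0 ∧ v x ≠ 1) (t : Kbar) (ht : t ≠ 0) :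
    ∃ c : K, c ≠ 0 ∧ v c ≤ 1 ∧ v c < w t := by
  obtain ⟨x, hx0, hx1⟩ : ∃ x : K, x ≠ 0 ∧ v x < 1 := by
    obtain ⟨x, h0, h1⟩ := hnontriv
    rcases lt_or_gt_of_ne h1 with h | h
    · exact ⟨x, h0, h⟩
    · refine ⟨x⁻¹, inv_ne_zero h0, ?_⟩
      rw [map_inv₀]
      exact inv_lt_one_of_one_lt₀ h
  rcases le_or_gt 1 (w t) with h | h
  · exact ⟨x, hx0, hx1.le, hx1.trans_le h⟩
  · obtain ⟨n, e, he⟩ := IsPurelyInseparable.pow_mem K (ringExpChar K) t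
    have hve : v e = w t ^ (ringExpChar K ^ n) := by rw [← hext, he, map_pow]
    have hq : ringExpChar K ^ n ≠ 0 := (expChar_pow_pos K (ringExpChar K) n).ne'
    have hwt : 0 < w t := zero_lt_iff.2 ((Valuation.ne_zero_iff w).2 ht)
    have hle : v e ≤ w t := by
      rw [hve]
      exact pow_le_of_le_one zero_le h.le hq
    have he0 : e ≠ 0 := by
      rintro rfl
      rw [map_zero] at he
      exact pow_ne_zero _ ht he.symm
    have hlt : v (e * x) < w t := by
      rw [map_mul]
      calc v e * v x ≤ w t * v x := mul_le_mul_left hle _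
        _ < w t * 1 := (mul_lt_mul_iff_right₀ hwt).2 hx1
        _ = w t := mul_one _
    exact ⟨e * x, mul_ne_zero he0 hx0, (hlt.trans h).le, hlt⟩


/-- **Density of a separably closed valued field in its algebraic closure.** Let `K` be
a separably closed field with a nontrivial valuation `v`, and let `Kbar` be an algebraic
closure of `K` equipped with a valuation `w` extending `v`. Then `K` is dense in `Kbar`
for the valuation topology: for every `a ∈ Kbar` and every `γ ≠ 0` in the value group of
`Kbar`, there is `b ∈ K` with `v(a − b) > γ` (multiplicatively: `w (a - b) < γ`). -/
theorem separablyClosed_dense_in_algebraic_closure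
    (K : Type) [Field K] [IsSepClosed K]
    (Kbar : Type) [Field Kbar] [Algebra K Kbar] [IsAlgClosure K Kbar]
    (Γ₀ : Type) [LinearOrderedCommGroupWithZero Γ₀]
    (v : Valuation K Γ₀) (w : Valuation Kbar Γ₀)
    (hext : ∀ x : K, w (algebraMap K Kbar x) = v x)
    (hnontriv : ∃ x : K, x ≠ 0 ∧ v x ≠ 1) :
    ∀ a : Kbar, ∀ γ : Γ₀, γ ≠ 0 → (∃ c : Kbar, w c = γ) →
      ∃ b : K, w (a - algebraMap K Kbar b) < γ := by
  intro a γ hγ ⟨c₀, hc₀⟩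
  have : IsPurelyInseparable K Kbar := by
    have := IsAlgClosure.isAlgebraic (R := K) (K := Kbar)
    infer_instance
  have hc₀0 : c₀ ≠ 0 := by
    rintro rfl
    exact hγ (by rw [← hc₀, map_zero])
  obtain ⟨n, d, hd⟩ := IsPurelyInseparable.pow_mem K (ringExpChar K) a
  have hpE : ExpChar K (ringExpChar K) := inferInstance
  generalize ringExpChar K = p at hpE hd
  have : ExpChar Kbar p := expChar_of_injective_algebraMap (algebraMap K Kbar).injective p
  by_cases hq1 : p ^ n = 1
  · refine ⟨d, ?_⟩
    rw [hd, hq1, pow_one, sub_self, map_zero]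
    exact zero_lt_iff.2 hγ
  have hqpos : 0 < p ^ n := expChar_pow_pos K p n
  have hqK : ((p ^ n : ℕ) : K) = 0 := by
    have hn : n ≠ 0 := by rintro rfl; simp at hq1
    have hpK : (p : K) = 0 := by
      cases hpE with
      | zero => simp at hq1
      | prime hpr => exact CharP.cast_eq_zero K p
    rw [Nat.cast_pow, hpK, zero_pow hn]
  obtain ⟨m, hm0, hm1, hmd⟩ : ∃ m : K, m ≠ 0 ∧ 1 ≤ v m ∧ v d ≤ v m := by
    rcases le_total 1 (v d) with h | h
    · refine ⟨d, ?_, h, le_rfl⟩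
      rintro rfl
      simp at h
    · exact ⟨1, one_ne_zero, by simp, by simpa using h⟩
  have hM0 : 0 < v m := zero_lt_one.trans_le hm1
  obtain ⟨c, hc0, hc1, hcs⟩ := aux_small v w hext hnontriv
    (c₀ ^ (p ^ n) / algebraMap K Kbar m) (div_ne_zero (pow_ne_zero _ hc₀0) (by simpa using hm0))
  rw [map_div₀, map_pow, hext, hc₀, lt_div_iff₀ hM0] at hcs
  obtain ⟨b, hb⟩ := IsSepClosed.exists_root_C_mul_X_pow_add_C_mul_X_add_C
    (n := p ^ n) (1 : K) (-c) (-d) hqK (by omega) (neg_ne_zero.2 hc0)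
  have hb' : b ^ (p ^ n) = c * b + d := by
    linear_combination hb
  have hvb : v b ≤ v m := by
    by_contra! hlt
    have h1 : 1 < v b := hm1.trans_lt hlt
    have h2 : v b < v b ^ (p ^ n) := lt_self_pow₀ h1 (by omega)
    have h3 : v b ^ (p ^ n) ≤ max (v (c * b)) (v d) := by
      rw [← map_pow, hb']
      exact v.map_add _ _
    have h4 : v (c * b) ≤ v b := by
      rw [map_mul]
      exact mul_le_of_le_one_left zero_le hc1
    exact absurd (h2.trans_le h3) (not_lt.2 (max_le h4 (hmd.trans hlt.le)))
  refine ⟨b, ?_⟩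
  have key : w (a - algebraMap K Kbar b) ^ (p ^ n) < γ ^ (p ^ n) := by
    rw [← map_pow, sub_pow_expChar_pow, ← hd, ← map_pow, hb', ← map_sub, hext,
      show d - (c * b + d) = -(c * b) by ring, Valuation.map_neg, map_mul]
    exact (mul_le_mul_right hvb _).trans_lt hcs
  exact lt_of_pow_lt_pow_left₀ _ zero_le key
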